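/- Let ξ_ν ∈ S(𝔫)^𝔫 be an 𝔥-weight vector of weight ν. Then ξ_ν is a homogeneous polynomial of degree r(ν) = Σ_{β∈ℬ} (ν,β)/(β,β) (each summand (ν,β)/(β,β) being a nonnegative integer), and there is a nonzero constant s such that for every t = Σ_{β∈ℬ} t_β e_{−β} ∈ 𝔯₋ˣ one has ξ_ν(t) = s · Π_{β∈ℬ} t_β^{(ν,β)/(β,β)}, where S(𝔫) is identified with the algebra of polynomial functions on 𝔫₋ via the Killing form pairing. -/

import Mathlib

open scoped InnerProductSpace BigOperators

structure RootSystemData (V : Type*) [NormedAddCommGroup V] [InnerProductSpace ℝ V] where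
  Δ : Set V
  finite : Δ.Finite
  span_top : Submodule.span ℝ Δ = ⊤
  zero_not_mem : (0 : V) ∉ Δ
  neg_mem : ∀ α ∈ Δ, -α ∈ Δ
  reduced : ∀ α ∈ Δ, ∀ t : ℝ, t • α ∈ Δ → t = 1 ∨ t = -1
  crystal : ∀ α ∈ Δ, ∀ β ∈ Δ, ∃ n : ℤ, 2 * ⟪α, β⟫_ℝ = (n : ℝ) * ⟪β, β⟫_ℝ
  reflect_mem : ∀ α ∈ Δ, ∀ β ∈ Δ, α - (2 * ⟪α, β⟫_ℝ / ⟪β, β⟫_ℝ) • β ∈ Δ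
  Pos : Set V
  pos_subset : Pos ⊆ Δ
  mem_or_neg : ∀ α ∈ Δ, α ∈ Pos ∨ -α ∈ Pos
  not_neg_mem : ∀ α ∈ Pos, -α ∉ Pos
  pos_add : ∀ α ∈ Pos, ∀ β ∈ Pos, α + β ∈ Δ → α + β ∈ Pos

namespace RootSystemData

variable {V : Type*} [NormedAddCommGroup V] [InnerProductSpace ℝ V] (R : RootSystemData V)

/-- The set of simple roots: indecomposable positive roots. -/
def Simple : Set V := {α ∈ R.Pos | ¬ ∃ β ∈ R.Pos, ∃ γ ∈ R.Pos, α = β + γ}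

/-- The support `Π(φ)` of a positive root: the simple roots needed to express `φ`. -/
def support (φ : V) : Set V := {α ∈ R.Simple | φ ∉ Submodule.span ℝ (R.Simple \ {α})}

/-- The root subsystem `Δ(φ)`: all roots lying in the span of the support of `φ`. -/
def sub (φ : V) : Set V := {ψ ∈ R.Δ | ψ ∈ Submodule.span ℝ (R.support φ)}

/-- The positive roots `Δ(φ)₊` of the subsystem `Δ(φ)`. -/
def posSub (φ : V) : Set V := R.sub φ ∩ R.Pos

/-- `x` is a nonnegative integer combination of positive roots. -/
def NonnegComb (x : V) : Prop :=
  ∃ c : V →₀ ℕ, ↑c.support ⊆ R.Pos ∧ x = c.sum fun α n => (n : ℝ) • α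

/-- `β` is the highest root of the subset `S`. -/
def IsHighest (S : Set V) (β : V) : Prop :=
  β ∈ S ∧ β ∈ R.Pos ∧ ∀ ψ ∈ S, R.NonnegComb (β - ψ)

/-- `β` is locally high: it is the highest root of `Δ(β)`. -/
def LocallyHigh (β : V) : Prop := β ∈ R.Pos ∧ R.IsHighest (R.sub β) β

/-- `E(β) = {φ ∈ Δ(β) : (φ,β) > 0}`. -/
def E (β : V) : Set V := {φ ∈ R.sub β | 0 < ⟪φ, β⟫_ℝ}

/-- `Δ(β)° = {φ ∈ Δ(β) : (φ,β) = 0}`. -/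
def orth (β : V) : Set V := {φ ∈ R.sub β | ⟪φ, β⟫_ℝ = 0}

/-- Strong orthogonality of two roots. -/
def StronglyOrth (φ ψ : V) : Prop := φ + ψ ∉ R.Δ ∧ φ - ψ ∉ R.Δ


/-- Half the sum of the positive roots of `Δ(β)`. -/
noncomputable def rho (β : V) : V := (2⁻¹ : ℝ) • ∑ᶠ φ ∈ R.posSub β, φ

/-- The dual Coxeter number of `Δ(β)`, `⟨ρ_β, β^∨⟩ + 1`. -/
noncomputable def dualCoxeter (β : V) : ℝ := 2 * ⟪R.rho β, β⟫_ℝ / ⟪β, β⟫_ℝ + 1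

end RootSystemData

/-- A finite set of vectors is irreducible if it is nonempty and admits no splitting into
two nonempty mutually orthogonal pieces. -/
def IsIrred {V : Type*} [NormedAddCommGroup V] [InnerProductSpace ℝ V] (S : Set V) : Prop :=
  S.Nonempty ∧ ¬ ∃ A B : Set V, A ∪ B = S ∧ A ∩ B = ∅ ∧ A.Nonempty ∧ B.Nonempty ∧
    ∀ a ∈ A, ∀ b ∈ B, ⟪a, b⟫_ℝ = 0

/-- `C` is an irreducible component of `S`. -/
def IsComponent {V : Type*} [NormedAddCommGroup V] [InnerProductSpace ℝ V]
    (S C : Set V) : Prop :=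
  C ⊆ S ∧ IsIrred C ∧ ∀ a ∈ C, ∀ b ∈ S \ C, ⟪a, b⟫_ℝ = 0

/-- The reflection `s_β` in the (co)vector `β`. -/
noncomputable def reflectRoot {V : Type*} [NormedAddCommGroup V] [InnerProductSpace ℝ V]
    (β v : V) : V := v - (2 * ⟪v, β⟫_ℝ / ⟪β, β⟫_ℝ) • β

namespace RootSystemData

variable {V : Type*} [NormedAddCommGroup V] [InnerProductSpace ℝ V] (R : RootSystemData V)

/-- A chain cascade: a nonempty list whose head is the highest root of an irreducible
component of `Δ`, and each subsequent entry is the highest root of an irreducible component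
of `Δ(previous)°`. -/
def IsChainCascade (l : List V) : Prop :=
  l ≠ [] ∧
  (∀ b ∈ l.head?, ∃ C, IsComponent R.Δ C ∧ R.IsHighest C b) ∧
  l.Chain' fun γ δ => ∃ C, IsComponent (R.orth γ) C ∧ R.IsHighest C δ

/-- The cascade `ℬ` of roots: all positive roots belonging to some chain cascade. -/
def cascade : Set V := {β | ∃ l, R.IsChainCascade l ∧ β ∈ l}

/-- `l` is the chain cascade `C(φ)` associated to the positive root `φ`. -/
def IsCascadeChainOf (φ : V) (l : List V) : Prop :=
  R.IsChainCascade l ∧ (∀ β ∈ l, φ ∈ R.sub β) ∧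
  (∀ β ∈ l.dropLast, ⟪φ, β⟫_ℝ = 0) ∧ ∀ β ∈ l.getLast?, 0 < ⟪φ, β⟫_ℝ

end RootSystemData

section LieSetup

variable (V : Type*) [NormedAddCommGroup V] [InnerProductSpace ℝ V]
  (L : Type*) [LieRing L] [LieAlgebra ℂ L] [Module.Finite ℂ L]

/-- A triangular decomposition of a finite-dimensional complex semisimple Lie algebra `L`,
with Cartan subalgebra `H`, root system `Δ` (realized in the real inner product space `V`,
the inner product being the one induced by the Killing form), chosen root vectors `e φ`,
and the projection `Φ : L → 𝔫₋` with kernel `𝔟 = 𝔥 ⊕ 𝔫`. -/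
structure CascadeLieData extends RootSystemData V where
  /-- the root vectors `e_φ` -/
  e : V → L
  /-- the Cartan subalgebra `𝔥` -/
  H : LieSubalgebra ℂ L
  /-- the realization of `V` inside `𝔥*`: each `φ ∈ V` gives a functional on `𝔥` -/
  wt : V →ₗ[ℝ] (H →ₗ[ℂ] ℂ)
  wt_inj : Function.Injective wt
  e_ne : ∀ φ ∈ Δ, e φ ≠ 0
  indep : LinearIndependent ℂ fun φ : Δ => e (φ : V)
  root_vec : ∀ x : H, ∀ φ ∈ Δ, ⁅(x : L), e φ⁆ = wt φ x • e φ
  bracket_add : ∀ φ ∈ Δ, ∀ ψ ∈ Δ, φ + ψ ∈ Δ →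
    ∃ c : ℂ, c ≠ 0 ∧ ⁅e φ, e ψ⁆ = c • e (φ + ψ)
  bracket_zero : ∀ φ ∈ Δ, ∀ ψ ∈ Δ, φ + ψ ∉ Δ → φ + ψ ≠ 0 → ⁅e φ, e ψ⁆ = 0
  bracket_opp : ∀ φ ∈ Δ, ⁅e φ, e (-φ)⁆ ∈ H
  span_eq_top : H.toSubmodule ⊔ Submodule.span ℂ (e '' Δ) = ⊤
  killing_pair : ∀ φ ∈ Δ, killingForm ℂ L (e φ) (e (-φ)) ≠ 0
  killing_orth : ∀ φ ∈ Δ, ∀ ψ ∈ Δ, φ + ψ ≠ 0 → killingForm ℂ L (e φ) (e ψ) = 0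
  /-- the projection `Φ : 𝔤 → 𝔫₋` with kernel `𝔟` -/
  Φ : L →ₗ[ℂ] L
  Φ_neg : ∀ z ∈ Submodule.span ℂ (e '' (Neg.neg '' Pos)), Φ z = z
  Φ_b : ∀ z ∈ H.toSubmodule ⊔ Submodule.span ℂ (e '' Pos), Φ z = 0

end LieSetup

namespace CascadeLieData

variable {V : Type*} [NormedAddCommGroup V] [InnerProductSpace ℝ V]
  {L : Type*} [LieRing L] [LieAlgebra ℂ L] [Module.Finite ℂ L]
  (C : CascadeLieData V L)

/-- The nilradical `𝔫 = ⊕_{φ∈Δ₊} 𝔤_φ`. -/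
def nSub : Submodule ℂ L := Submodule.span ℂ (C.e '' C.Pos)

/-- The opposite nilradical `𝔫₋`. -/
def nMinus : Submodule ℂ L := Submodule.span ℂ (C.e '' (Neg.neg '' C.Pos))

/-- The Borel subalgebra `𝔟 = 𝔥 ⊕ 𝔫` (as a subspace). -/
def bSub : Submodule ℂ L := C.H.toSubmodule ⊔ C.nSub

/-- `𝔯 = span{e_β : β ∈ ℬ}`. -/
def rSub : Submodule ℂ L := Submodule.span ℂ (C.e '' C.toRootSystemData.cascade)

/-- `𝔯₋ = span{e_{−β} : β ∈ ℬ}`. -/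
def rMinus : Submodule ℂ L :=
  Submodule.span ℂ (C.e '' (Neg.neg '' C.toRootSystemData.cascade))

/-- `𝔯₋ˣ`: the elements of `𝔯₋` all of whose coefficients are nonzero. -/
def rMinusX : Set L :=
  {z | ∃ a : V → ℂ, (∀ β ∈ C.toRootSystemData.cascade, a β ≠ 0) ∧
    z = ∑ᶠ β ∈ C.toRootSystemData.cascade, a β • C.e (-β)}

/-- `𝔰 = span{e_φ : φ ∈ Δ₊ \ ℬ}`. -/
def sSub : Submodule ℂ L :=
  Submodule.span ℂ (C.e '' (C.Pos \ C.toRootSystemData.cascade))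

/-- `𝔰₋ = span{e_{−φ} : φ ∈ Δ₊ \ ℬ}`. -/
def sMinus : Submodule ℂ L :=
  Submodule.span ℂ (C.e '' (Neg.neg '' (C.Pos \ C.toRootSystemData.cascade)))

/-- `𝔰(β) = span{e_φ : φ ∈ E(β), φ ≠ β}`. -/
def sBeta (β : V) : Submodule ℂ L :=
  Submodule.span ℂ (C.e '' (C.toRootSystemData.E β \ {β}))

/-- `𝔰(−β) = span{e_{−φ} : φ ∈ E(β), φ ≠ β}`. -/
def sBetaMinus (β : V) : Submodule ℂ L :=
  Submodule.span ℂ (C.e '' (Neg.neg '' (C.toRootSystemData.E β \ {β})))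

/-- `𝔢(β) = span{e_φ : φ ∈ E(β)}`. -/
def eSub (β : V) : Submodule ℂ L := Submodule.span ℂ (C.e '' C.toRootSystemData.E β)

/-- `𝔤(β)`: the Lie subalgebra generated by the root spaces `𝔤_{±α}`, `α ∈ Π(β)`. -/
def gSub (β : V) : LieSubalgebra ℂ L :=
  LieSubalgebra.lieSpan ℂ L
    (C.e '' C.toRootSystemData.support β ∪ C.e '' (Neg.neg '' C.toRootSystemData.support β))

end CascadeLieData

/-! ### Root system preliminaries -/

section Reflection

variable {V : Type*} [NormedAddCommGroup V] [InnerProductSpace ℝ V]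

lemma inner_reflectRoot_self {β : V} (hβ : 0 < ⟪β, β⟫_ℝ) (v : V) :
    ⟪reflectRoot β v, β⟫_ℝ = -⟪v, β⟫_ℝ := by
  rw [reflectRoot, inner_sub_left, real_inner_smul_left]
  field_simp
  ring

lemma reflectRoot_reflectRoot {β : V} (hβ : 0 < ⟪β, β⟫_ℝ) (v : V) :
    reflectRoot β (reflectRoot β v) = v := by
  rw [reflectRoot, inner_reflectRoot_self hβ, reflectRoot, sub_sub, ← add_smul]
  simp [neg_div]

end Reflection

namespace RootSystemData

variable {V : Type*} [NormedAddCommGroup V] [InnerProductSpace ℝ V] (R : RootSystemData V)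

lemma inner_self_pos {α : V} (hα : α ∈ R.Δ) : 0 < ⟪α, α⟫_ℝ := by
  rw [real_inner_self_eq_norm_sq]
  have : α ≠ 0 := fun h => R.zero_not_mem (h ▸ hα)
  positivity

lemma ne_zero_of_pos {α : V} (hα : α ∈ R.Pos) : α ≠ 0 :=
  fun h => R.zero_not_mem (h ▸ R.pos_subset hα)

lemma reflectRoot_mem {α β : V} (hα : α ∈ R.Δ) (hβ : β ∈ R.Δ) : reflectRoot β α ∈ R.Δ :=
  R.reflect_mem α hα β hβ

/-- If two distinct roots form an acute angle, their difference is a root. -/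
lemma sub_mem {α β : V} (hα : α ∈ R.Δ) (hβ : β ∈ R.Δ) (h : 0 < ⟪α, β⟫_ℝ) (hne : α ≠ β) :
    α - β ∈ R.Δ := by
  obtain ⟨n, hn⟩ := R.crystal α hα β hβ
  obtain ⟨m, hm⟩ := R.crystal β hβ α hα
  have ha := R.inner_self_pos hα
  have hb := R.inner_self_pos hβ
  have hsymm := real_inner_comm α β
  rw [hsymm] at hm
  have hn0 : 0 < n := by
    have : (0 : ℝ) < n := by by_contra hc; nlinarith [not_lt.1 hc]
    exact_mod_cast this
  have hm0 : 0 < m := by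
    have : (0 : ℝ) < m := by by_contra hc; nlinarith [not_lt.1 hc]
    exact_mod_cast this
  have key : (4 : ℝ) * (⟪α, β⟫_ℝ * ⟪α, β⟫_ℝ) = n * m * (⟪α, α⟫_ℝ * ⟪β, β⟫_ℝ) := by
    linear_combination (2 * ⟪α, β⟫_ℝ) * hn + (n * ⟪β, β⟫_ℝ) * hm
  have hlt : n * m < 4 := by
    by_contra! hc
    have hc' : (4 : ℝ) ≤ n * m := by exact_mod_cast hc
    have hcs : ⟪α, α⟫_ℝ * ⟪β, β⟫_ℝ ≤ ⟪α, β⟫_ℝ * ⟪α, β⟫_ℝ := by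
      nlinarith [mul_pos ha hb]
    have hz : ⟪⟪β, β⟫_ℝ • α - ⟪α, β⟫_ℝ • β, ⟪β, β⟫_ℝ • α - ⟪α, β⟫_ℝ • β⟫_ℝ ≤ 0 := by
      simp only [inner_sub_left, inner_sub_right, real_inner_smul_left, real_inner_smul_right,
        hsymm]
      nlinarith
    have hz' : ⟪β, β⟫_ℝ • α = ⟪α, β⟫_ℝ • β := sub_eq_zero.1 (real_inner_self_nonpos.1 hz)
    have hα' : α = (⟪α, β⟫_ℝ / ⟪β, β⟫_ℝ) • β := by
      rw [div_eq_inv_mul, mul_smul, ← hz', smul_smul, inv_mul_cancel₀ hb.ne', one_smul]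
    rcases R.reduced β hβ _ (hα' ▸ hα) with h1 | h1
    · rw [h1, one_smul] at hα'; exact hne hα'
    · have : 0 < ⟪α, β⟫_ℝ / ⟪β, β⟫_ℝ := by positivity
      linarith
  have h1 : n = 1 ∨ m = 1 := by
    by_contra! hc
    have : 2 ≤ n := by have := hc.1; omega
    have : 2 ≤ m := by have := hc.2; omega
    nlinarith
  rcases h1 with rfl | rfl
  · have := R.reflect_mem α hα β hβ
    rwa [hn, Int.cast_one, one_mul, div_self hb.ne', one_smul] at this
  · have := R.neg_mem _ (R.reflect_mem β hβ α hα)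
    rwa [hsymm, hm, Int.cast_one, one_mul, div_self ha.ne', one_smul, neg_sub] at this

lemma add_mem {α β : V} (hα : α ∈ R.Δ) (hβ : β ∈ R.Δ) (h : ⟪α, β⟫_ℝ < 0) (hne : α + β ≠ 0) :
    α + β ∈ R.Δ := by
  rw [← sub_neg_eq_add]
  refine R.sub_mem hα (R.neg_mem β hβ) (by rw [inner_neg_right]; linarith) ?_
  rwa [Ne, ← sub_eq_zero, sub_neg_eq_add]

lemma pos_add_ne_zero {α β : V} (hα : α ∈ R.Pos) (hβ : β ∈ R.Pos) : α + β ≠ 0 := fun h =>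
  R.not_neg_mem α hα (by rwa [neg_eq_of_add_eq_zero_right h])

lemma exists_inner_neg_of_inner_sum_neg (a : V) (t : Multiset V) (h : ⟪a, t.sum⟫_ℝ < 0) :
    ∃ b ∈ t, ⟪a, b⟫_ℝ < 0 := by
  induction t using Multiset.induction with
  | empty => simp at h
  | cons b u ih =>
    rw [Multiset.sum_cons, inner_add_right] at h
    by_cases hb : ⟪a, b⟫_ℝ < 0
    · exact ⟨b, by simp, hb⟩
    · obtain ⟨c, hc, hac⟩ := ih (by linarith)
      exact ⟨c, by simp [hc], hac⟩

/-- A nonempty sum of positive roots does not vanish. -/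
lemma multiset_sum_ne_zero (s : Multiset V) (hs : ∀ x ∈ s, x ∈ R.Pos) (h0 : s ≠ 0) :
    s.sum ≠ 0 := by
  induction hn : s.card using Nat.strong_induction_on generalizing s with
  | _ n ih =>
    obtain ⟨a, ha⟩ := Multiset.exists_mem_of_ne_zero h0
    obtain ⟨t, rfl⟩ := Multiset.exists_cons_of_mem ha
    intro hsum
    rw [Multiset.sum_cons] at hsum
    have haP := hs a (by simp)
    have hneg : ⟪a, t.sum⟫_ℝ < 0 := by
      rw [← neg_eq_of_add_eq_zero_right hsum, inner_neg_right]
      linarith [R.inner_self_pos (R.pos_subset haP)]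
    obtain ⟨b, hb, hab⟩ := exists_inner_neg_of_inner_sum_neg a t hneg
    obtain ⟨u, rfl⟩ := Multiset.exists_cons_of_mem hb
    have hbP := hs b (by simp)
    have hadd := R.pos_add a haP b hbP
      (R.add_mem (R.pos_subset haP) (R.pos_subset hbP) hab (R.pos_add_ne_zero haP hbP))
    refine ih _ ?_ ((a + b) ::ₘ u) ?_ (by simp) rfl ?_
    · rw [← hn]; simp
    · intro x hx
      rcases Multiset.mem_cons.1 hx with rfl | hx
      · exact hadd
      · exact hs x (by simp [hx])
    · rw [Multiset.sum_cons, ← hsum, Multiset.sum_cons, add_assoc]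

lemma pos_finite : R.Pos.Finite := R.finite.subset R.pos_subset

/-- The functional given by pairing with the sum of all positive roots. -/
noncomputable def htForm : V →ₗ[ℝ] ℝ := ∑ β ∈ R.pos_finite.toFinset, innerₗ V β

lemma htForm_pos {α : V} (hα : α ∈ R.Pos) : 0 < R.htForm α := by
  classical
  have hαΔ := R.pos_subset hα
  have ha := R.inner_self_pos hαΔ
  have : R.htForm α = ∑ β ∈ R.pos_finite.toFinset, ⟪β, α⟫_ℝ := by simp [htForm]
  rw [this, ← Finset.sum_filter_add_sum_filter_not _ (fun β => reflectRoot α β ∈ R.Pos)]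
  have h1 : ∑ β ∈ R.pos_finite.toFinset with reflectRoot α β ∈ R.Pos, ⟪β, α⟫_ℝ = 0 := by
    refine Finset.sum_involution (fun β _ => reflectRoot α β) ?_ ?_ ?_ ?_
    · intro β _; simp [inner_reflectRoot_self ha]
    · intro β _ h0 h
      have := inner_reflectRoot_self ha β
      rw [h] at this
      exact h0 (by linarith)
    · intro β hβ
      simp only [Finset.mem_filter, Set.Finite.mem_toFinset] at hβ ⊢
      exact ⟨hβ.2, by rw [reflectRoot_reflectRoot ha]; exact hβ.1⟩
    · intro β _; exact reflectRoot_reflectRoot ha β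
  rw [h1, zero_add]
  refine Finset.sum_pos ?_ ⟨α, ?_⟩
  · intro β hβ
    simp only [Finset.mem_filter, Set.Finite.mem_toFinset] at hβ
    obtain ⟨hβ, hr⟩ := hβ
    have hγ : -reflectRoot α β ∈ R.Pos :=
      (R.mem_or_neg _ (R.reflectRoot_mem (R.pos_subset hβ) hαΔ)).resolve_left hr
    obtain ⟨n, hn⟩ := R.crystal β (R.pos_subset hβ) α hαΔ
    have hn0 : 0 < n := by
      by_contra! hc
      obtain ⟨k, hk⟩ := Int.eq_ofNat_of_zero_le (neg_nonneg.2 hc)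
      refine R.multiset_sum_ne_zero
        ((-reflectRoot α β) ::ₘ β ::ₘ Multiset.replicate k α) ?_ (by simp) ?_
      · intro x hx
        simp only [Multiset.mem_cons, Multiset.mem_replicate] at hx
        rcases hx with rfl | rfl | ⟨-, rfl⟩ <;> assumption
      · have hnk : (n : ℝ) = -(k : ℝ) := by
          have : n = -(k : ℤ) := by omega
          rw [this]; push_cast; rfl
        rw [Multiset.sum_cons, Multiset.sum_cons, Multiset.sum_replicate, reflectRoot, hn,
          mul_div_assoc, div_self ha.ne', mul_one, hnk, ← Nat.cast_smul_eq_nsmul ℝ]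
        module
    have : (0 : ℝ) < n := by exact_mod_cast hn0
    nlinarith
  · simp only [Finset.mem_filter, Set.Finite.mem_toFinset]
    refine ⟨hα, fun h => R.not_neg_mem α hα ?_⟩
    have : reflectRoot α α = -α := by
      rw [reflectRoot, mul_div_assoc, div_self ha.ne']; module
    rwa [← this]

lemma inner_simple_nonpos {α β : V} (hα : α ∈ R.Simple) (hβ : β ∈ R.Simple) (hne : α ≠ β) :
    ⟪α, β⟫_ℝ ≤ 0 := by
  by_contra! h
  rcases R.mem_or_neg _ (R.sub_mem (R.pos_subset hα.1) (R.pos_subset hβ.1) h hne) with h' | h'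
  · exact hα.2 ⟨α - β, h', β, hβ.1, by abel⟩
  · exact hβ.2 ⟨-(α - β), h', α, hα.1, by abel⟩

lemma simple_linearIndependent : LinearIndependent ℝ ((↑) : R.Simple → V) := by
  refine LinearMap.BilinForm.linearIndependent_of_pairwise_le_zero (innerₗ V) ?_ R.htForm _
    (fun i => R.htForm_pos i.2.1) ?_
  · intro x hx
    simpa using pow_pos (norm_pos_iff.2 hx) 2
  · intro i j hij
    simpa using R.inner_simple_nonpos i.2 j.2 (fun h => hij (Subtype.ext h))

/-- Induction on positive roots through sums of positive roots. -/
lemma pos_induction {p : V → Prop} (hs : ∀ α ∈ R.Simple, p α)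
    (hadd : ∀ α ∈ R.Pos, ∀ β ∈ R.Pos, p α → p β → p (α + β)) {α : V} (hα : α ∈ R.Pos) : p α := by
  by_contra hp
  obtain ⟨a, ⟨haP, hap⟩, hmin⟩ := Set.exists_min_image {x ∈ R.Pos | ¬ p x} R.htForm
    (R.pos_finite.subset fun x hx => hx.1) ⟨α, hα, hp⟩
  have hns : a ∉ R.Simple := fun h => hap (hs a h)
  simp only [Simple, Set.mem_ofPred_eq, not_and, not_not] at hns
  obtain ⟨β, hβ, γ, hγ, rfl⟩ := hns haP
  have h1 := R.htForm_pos hβ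
  have h2 := R.htForm_pos hγ
  rw [map_add] at hmin
  refine hap (hadd β hβ γ hγ ?_ ?_)
  · by_contra h; linarith [hmin β ⟨hβ, h⟩]
  · by_contra h; linarith [hmin γ ⟨hγ, h⟩]

lemma top_le_span_simple : ⊤ ≤ Submodule.span ℝ (Set.range ((↑) : R.Simple → V)) := by
  rw [← R.span_top, Subtype.range_coe, Submodule.span_le]
  have hpos : ∀ α ∈ R.Pos, α ∈ Submodule.span ℝ R.Simple := fun α hα =>
    R.pos_induction (p := fun α => α ∈ Submodule.span ℝ R.Simple)
      (fun α h => Submodule.subset_span h) (fun _ _ _ _ h h' => Submodule.add_mem _ h h') hα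
  intro α hα
  rcases R.mem_or_neg α hα with h | h
  · exact hpos α h
  · simpa using Submodule.neg_mem _ (hpos _ h)

/-- The basis of simple roots. -/
noncomputable def simpleBasis : Module.Basis R.Simple ℝ V :=
  Module.Basis.mk R.simple_linearIndependent R.top_le_span_simple

lemma simpleBasis_apply (α : R.Simple) : R.simpleBasis α = α := by simp [simpleBasis]

lemma repr_simple (α : R.Simple) : R.simpleBasis.repr (α : V) = Finsupp.single α 1 := by
  rw [← R.simpleBasis.repr_self, simpleBasis_apply]

lemma repr_nonneg {φ : V} (hφ : φ ∈ R.Pos) (α : R.Simple) : 0 ≤ R.simpleBasis.repr φ α := by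
  classical
  refine R.pos_induction (p := fun φ => 0 ≤ R.simpleBasis.repr φ α) ?_ ?_ hφ
  · intro β hβ
    rw [R.repr_simple ⟨β, hβ⟩, Finsupp.single_apply]
    split_ifs <;> norm_num
  · intro β _ γ _ h h'
    rw [map_add, Finsupp.add_apply]
    exact add_nonneg h h'

lemma repr_nonneg_of_nonnegComb {x : V} (hx : R.NonnegComb x) (α : R.Simple) :
    0 ≤ R.simpleBasis.repr x α := by
  obtain ⟨c, hc, rfl⟩ := hx
  rw [Finsupp.sum, map_sum, Finsupp.finsetSum_apply]
  refine Finset.sum_nonneg fun φ hφ => ?_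
  rw [map_smul, Finsupp.smul_apply, smul_eq_mul]
  exact mul_nonneg (Nat.cast_nonneg _) (R.repr_nonneg (hc hφ) α)

lemma eq_zero_of_repr_nonneg {x : V} (h : ∀ α, 0 ≤ R.simpleBasis.repr x α)
    (h' : ∀ α, 0 ≤ R.simpleBasis.repr (-x) α) : x = 0 := by
  refine R.simpleBasis.ext_elem fun α => ?_
  have := h' α
  rw [map_neg, Finsupp.neg_apply] at this
  rw [map_zero, Finsupp.zero_apply]
  linarith [h α]

lemma nonnegComb_of_pos {φ : V} (hφ : φ ∈ R.Pos) : R.NonnegComb φ := by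
  classical
  refine ⟨Finsupp.single φ 1, ?_, by simp⟩
  intro x hx
  have := Finsupp.support_single_subset hx
  rw [Finset.mem_singleton] at this
  exact this ▸ hφ

lemma NonnegComb.add {x y : V} (hx : R.NonnegComb x) (hy : R.NonnegComb y) :
    R.NonnegComb (x + y) := by
  classical
  obtain ⟨c, hc, rfl⟩ := hx
  obtain ⟨d, hd, rfl⟩ := hy
  refine ⟨c + d, fun φ hφ => ?_, ?_⟩
  · rcases Finset.mem_union.1 (Finsupp.support_add hφ) with h | h
    · exact hc h
    · exact hd h
  · rw [Finsupp.sum_add_index'] <;> simp [add_smul]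

lemma nonnegComb_zero : R.NonnegComb 0 := ⟨0, by simp, by simp⟩

lemma inner_eq_sum (x y : V) :
    ⟪x, y⟫_ℝ = (R.simpleBasis.repr x).sum fun α c => c * ⟪(α : V), y⟫_ℝ := by
  conv_lhs => rw [← R.simpleBasis.linearCombination_repr x]
  rw [Finsupp.linearCombination_apply, Finsupp.sum_inner]
  refine Finsupp.sum_congr fun α _ => ?_
  simp [real_inner_smul_left, simpleBasis_apply]

/-- The roots supported on a set of simple roots. -/
def levi (T : Set R.Simple) : Set V := {ψ ∈ R.Δ | ↑(R.simpleBasis.repr ψ).support ⊆ T}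

lemma mem_span_image_simple {x : V} {T : Set R.Simple} :
    x ∈ Submodule.span ℝ ((↑) '' T : Set V) ↔ ↑(R.simpleBasis.repr x).support ⊆ T := by
  rw [← Module.Basis.mem_span_image]
  have : (Subtype.val : R.Simple → V) = R.simpleBasis :=
    funext fun α => (R.simpleBasis_apply α).symm
  rw [this]

lemma support_eq (φ : V) :
    R.support φ = (↑) '' (↑(R.simpleBasis.repr φ).support : Set R.Simple) := by
  have key : ∀ α : R.Simple, φ ∉ Submodule.span ℝ (R.Simple \ {(α : V)}) ↔
      α ∈ (R.simpleBasis.repr φ).support := by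
    intro α
    have : R.Simple \ {(α : V)} = (↑) '' ({α}ᶜ : Set R.Simple) := by
      ext x; simp only [Set.mem_sdiff, Set.mem_singleton_iff, Set.mem_image, Set.mem_compl_iff]
      constructor
      · rintro ⟨h, h'⟩
        exact ⟨⟨x, h⟩, fun e => h' (congrArg Subtype.val e), rfl⟩
      · rintro ⟨y, hy, rfl⟩
        exact ⟨y.2, fun e => hy (Subtype.ext e)⟩
    rw [this, mem_span_image_simple, Set.subset_compl_singleton_iff, not_not, Finset.mem_coe]
  ext x
  simp only [support, Set.mem_image]
  constructor
  · rintro ⟨h, h'⟩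
    exact ⟨⟨x, h⟩, (key ⟨x, h⟩).1 h', rfl⟩
  · rintro ⟨y, hy, rfl⟩
    exact ⟨y.2, (key y).2 hy⟩

lemma sub_eq_levi (φ : V) : R.sub φ = R.levi (R.simpleBasis.repr φ).support := by
  ext ψ
  simp only [sub, levi, Set.mem_ofPred_eq, support_eq, mem_span_image_simple]

lemma levi_univ : R.levi Set.univ = R.Δ := by
  ext ψ; simp [levi]

variable {R}

lemma neg_mem_levi {T : Set R.Simple} {ψ : V} (h : ψ ∈ R.levi T) : -ψ ∈ R.levi T :=
  ⟨R.neg_mem ψ h.1, by rw [map_neg, Finsupp.support_neg]; exact h.2⟩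

lemma support_add_subset {T : Set R.Simple} {x y : V}
    (hx : ↑(R.simpleBasis.repr x).support ⊆ T) (hy : ↑(R.simpleBasis.repr y).support ⊆ T) :
    ↑(R.simpleBasis.repr (x + y)).support ⊆ T := by
  classical
  rw [map_add]
  intro α hα
  rcases Finset.mem_union.1 (Finsupp.support_add hα) with h | h
  · exact hx h
  · exact hy h

lemma add_mem_levi {T : Set R.Simple} {x y : V} (hx : x ∈ R.levi T) (hy : y ∈ R.levi T)
    (h : x + y ∈ R.Δ) : x + y ∈ R.levi T :=
  ⟨h, support_add_subset hx.2 hy.2⟩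

lemma support_subset_add_left {x y : V} (hx : ∀ α, 0 ≤ R.simpleBasis.repr x α)
    (hy : ∀ α, 0 ≤ R.simpleBasis.repr y α) :
    (R.simpleBasis.repr x).support ⊆ (R.simpleBasis.repr (x + y)).support := by
  intro α hα
  rw [Finsupp.mem_support_iff] at hα ⊢
  rw [map_add, Finsupp.add_apply]
  have := (hx α).lt_of_ne' hα
  linarith [hy α, this]

lemma mem_levi_of_add_mem_levi {T : Set R.Simple} {x y : V} (hx : x ∈ R.Pos) (hy : y ∈ R.Pos)
    (h : x + y ∈ R.levi T) : x ∈ R.levi T ∧ y ∈ R.levi T := by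
  refine ⟨⟨R.pos_subset hx, ?_⟩, ⟨R.pos_subset hy, ?_⟩⟩
  · exact (Finset.coe_subset.2 (support_subset_add_left (R.repr_nonneg hx) (R.repr_nonneg hy))).trans
      h.2
  · rw [add_comm] at h
    exact (Finset.coe_subset.2 (support_subset_add_left (R.repr_nonneg hy) (R.repr_nonneg hx))).trans
      h.2

lemma component_neg {T : Set R.Simple} {C : Set V} (hC : IsComponent (R.levi T) C) {ψ : V}
    (hψ : ψ ∈ C) : -ψ ∈ C := by
  by_contra h
  have := hC.2.2 ψ hψ (-ψ) ⟨neg_mem_levi (hC.1 hψ), h⟩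
  rw [inner_neg_right] at this
  linarith [R.inner_self_pos (hC.1 hψ).1]

lemma component_add {T : Set R.Simple} {C : Set V} (hC : IsComponent (R.levi T) C) {x y : V}
    (hx : x ∈ C) (hy : y ∈ C) (h : x + y ∈ R.Δ) : x + y ∈ C := by
  by_contra hn
  have hl := add_mem_levi (hC.1 hx) (hC.1 hy) h
  have h1 := hC.2.2 x hx _ ⟨hl, hn⟩
  have h2 := hC.2.2 y hy _ ⟨hl, hn⟩
  have h3 := R.inner_self_pos h
  nth_rw 1 [inner_add_left] at h3
  linarith

lemma component_split {T : Set R.Simple} {C : Set V} (hC : IsComponent (R.levi T) C) {x y : V}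
    (hx : x ∈ R.Pos) (hy : y ∈ R.Pos) (h : x + y ∈ C) : x ∈ C ∧ y ∈ C := by
  obtain ⟨hxl, hyl⟩ := mem_levi_of_add_mem_levi hx hy (hC.1 h)
  have hxx := R.inner_self_pos hxl.1
  have hyy := R.inner_self_pos hyl.1
  have hpp := R.inner_self_pos (hC.1 h).1
  have key1 : x ∉ C → ⟪x, x⟫_ℝ + ⟪x, y⟫_ℝ = 0 := fun hn => by
    have := hC.2.2 _ h x ⟨hxl, hn⟩
    rw [inner_add_left, real_inner_comm] at this
    rw [real_inner_comm y x] at *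
    linarith
  have key2 : y ∉ C → ⟪x, y⟫_ℝ + ⟪y, y⟫_ℝ = 0 := fun hn => by
    have := hC.2.2 _ h y ⟨hyl, hn⟩
    rwa [inner_add_left] at this
  rw [inner_add_left, inner_add_right, inner_add_right, real_inner_comm x y] at hpp
  by_cases h1 : x ∈ C <;> by_cases h2 : y ∈ C
  · exact ⟨h1, h2⟩
  · have := hC.2.2 x h1 y ⟨hyl, h2⟩
    linarith [key2 h2]
  · have := hC.2.2 y h2 x ⟨hxl, h1⟩
    rw [real_inner_comm] at this
    linarith [key1 h1]
  · linarith [key1 h1, key2 h2]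

lemma simple_mem_component {T : Set R.Simple} {C : Set V} (hC : IsComponent (R.levi T) C) {ψ : V}
    (hψ : ψ ∈ R.Pos) (h : ψ ∈ C) {α : R.Simple} (hα : R.simpleBasis.repr ψ α ≠ 0) :
    (α : V) ∈ C := by
  classical
  revert h hα
  refine R.pos_induction
    (p := fun ψ => ψ ∈ C → R.simpleBasis.repr ψ α ≠ 0 → (α : V) ∈ C) ?_ ?_ hψ
  · intro β hβ h hα
    rw [R.repr_simple ⟨β, hβ⟩, Finsupp.single_apply] at hα
    have : (⟨β, hβ⟩ : R.Simple) = α := by by_contra hc; simp [hc] at hα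
    exact this ▸ h
  · intro β hβ γ hγ h1 h2 h hα
    obtain ⟨hb, hc⟩ := component_split hC hβ hγ h
    by_cases h0 : R.simpleBasis.repr β α = 0
    · refine h2 hc fun h' => hα ?_
      rw [map_add, Finsupp.add_apply, h0, h', add_zero]
    · exact h1 hb h0

/-- A component of a Levi subsystem with highest root `b` is the subsystem `Δ(b)`. -/
lemma component_eq_sub {T : Set R.Simple} {C : Set V} (hC : IsComponent (R.levi T) C) {b : V}
    (hb : R.IsHighest C b) : C = R.sub b := by
  rw [sub_eq_levi]
  obtain ⟨hbC, hbP, hmax⟩ := hb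
  apply Set.Subset.antisymm
  · intro ψ hψ
    refine ⟨(hC.1 hψ).1, fun α hα => ?_⟩
    rw [Finset.mem_coe, Finsupp.mem_support_iff] at hα ⊢
    intro h0
    have h1 := R.repr_nonneg_of_nonnegComb (hmax ψ hψ) α
    have h2 := R.repr_nonneg_of_nonnegComb (hmax _ (component_neg hC hψ)) α
    rw [map_sub, Finsupp.sub_apply, h0] at h1 h2
    rw [map_neg, Finsupp.neg_apply] at h2
    exact hα (by linarith)
  · intro ψ hψ
    by_contra hn
    have hψT : ψ ∈ R.levi T := ⟨hψ.1, hψ.2.trans (hC.1 hbC).2⟩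
    have h0 : ⟪ψ, ψ⟫_ℝ = 0 := by
      rw [R.inner_eq_sum]
      refine Finset.sum_eq_zero fun α hα => ?_
      have := hC.2.2 α (simple_mem_component hC hbP hbC (Finsupp.mem_support_iff.1 (hψ.2 hα)))
        ψ ⟨hψT, hn⟩
      simp [this]
    linarith [R.inner_self_pos hψ.1]

lemma not_highest_add {b ψ : V} (hb : R.IsHighest (R.sub b) b) (hψ : ψ ∈ R.sub b)
    (hψP : ψ ∈ R.Pos) : b + ψ ∉ R.Δ := by
  intro h
  have hbψ : b + ψ ∈ R.sub b := by
    rw [sub_eq_levi] at hψ ⊢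
    exact add_mem_levi ⟨R.pos_subset hb.2.1, subset_rfl⟩ hψ h
  have h1 := hb.2.2 _ hbψ
  rw [sub_add_cancel_left] at h1
  exact R.ne_zero_of_pos hψP
    (R.eq_zero_of_repr_nonneg (R.repr_nonneg hψP) (R.repr_nonneg_of_nonnegComb h1))

lemma inner_nonneg_of_highest {b ψ : V} (hb : R.IsHighest (R.sub b) b) (hψ : ψ ∈ R.sub b)
    (hψP : ψ ∈ R.Pos) : 0 ≤ ⟪ψ, b⟫_ℝ := by
  by_contra! h
  rw [real_inner_comm] at h
  exact not_highest_add hb hψ hψP (R.add_mem (R.pos_subset hb.2.1) (R.pos_subset hψP) h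
    (R.pos_add_ne_zero hb.2.1 hψP))

lemma orth_eq_levi {b : V} (hb : R.IsHighest (R.sub b) b) :
    R.orth b = R.levi {α | α ∈ (R.simpleBasis.repr b).support ∧ ⟪(α : V), b⟫_ℝ = 0} := by
  have key : ∀ ψ ∈ R.Pos, ψ ∈ R.sub b → ⟪ψ, b⟫_ℝ = 0 →
      ∀ α ∈ (R.simpleBasis.repr ψ).support, ⟪(α : V), b⟫_ℝ = 0 := by
    intro ψ hψP hψ h0 α hα
    rw [R.inner_eq_sum, Finsupp.sum, Finset.sum_eq_zero_iff_of_nonneg] at h0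
    · exact (mul_eq_zero.1 (h0 α hα)).resolve_left (Finsupp.mem_support_iff.1 hα)
    · intro α hα
      refine mul_nonneg (R.repr_nonneg hψP α) (inner_nonneg_of_highest hb ?_ α.2.1)
      rw [sub_eq_levi] at hψ ⊢
      refine ⟨R.pos_subset α.2.1, ?_⟩
      rw [R.repr_simple]
      exact (Finset.coe_subset.2 Finsupp.support_single_subset).trans
        (by simpa using hψ.2 hα)
  ext ψ
  constructor
  · rintro ⟨hψ, h0⟩
    have hψ' := hψ
    rw [sub_eq_levi] at hψ'
    refine ⟨hψ.1, fun α hα => ⟨hψ'.2 hα, ?_⟩⟩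
    rcases R.mem_or_neg ψ hψ.1 with h | h
    · exact key ψ h hψ h0 α hα
    · refine key (-ψ) h ?_ (by rw [inner_neg_left, h0, neg_zero]) α ?_
      · rw [sub_eq_levi]; exact neg_mem_levi hψ'
      · rwa [map_neg, Finsupp.support_neg]
  · rintro ⟨hψ, hs⟩
    refine ⟨?_, ?_⟩
    · rw [sub_eq_levi]; exact ⟨hψ, fun α hα => (hs hα).1⟩
    · rw [R.inner_eq_sum]
      refine Finset.sum_eq_zero fun α hα => ?_
      simp [(hs hα).2]

end RootSystemData

section Component

variable {V : Type*} [NormedAddCommGroup V] [InnerProductSpace ℝ V]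

lemma exists_component {S : Set V} {φ : V} (hφ : φ ∈ S) : ∃ C, IsComponent S C ∧ φ ∈ C := by
  let r : V → V → Prop := fun x y => y ∈ S ∧ ⟪x, y⟫_ℝ ≠ 0
  have hsub : ∀ ψ, Relation.ReflTransGen r φ ψ → ψ ∈ S := by
    intro ψ h
    induction h with
    | refl => exact hφ
    | tail _ h _ => exact h.1
  refine ⟨{ψ | Relation.ReflTransGen r φ ψ}, ⟨hsub, ⟨⟨φ, .refl⟩, ?_⟩, ?_⟩, .refl⟩
  · have key : ∀ A B : Set V, A ∪ B = {ψ | Relation.ReflTransGen r φ ψ} → A ∩ B = ∅ →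
        B.Nonempty → (∀ a ∈ A, ∀ b ∈ B, ⟪a, b⟫_ℝ = 0) → φ ∉ A := by
      intro A B hu hi hB ho hA
      have : ∀ ψ, Relation.ReflTransGen r φ ψ → ψ ∈ A := by
        intro ψ h
        induction h with
        | refl => exact hA
        | @tail x y h1 h2 ih =>
          have : y ∈ A ∪ B := by rw [hu]; exact h1.tail h2
          rcases this with h | h
          · exact h
          · exact absurd (ho x ih y h) h2.2
      obtain ⟨b, hb⟩ := hB
      have hbA : b ∈ A := this b (by
        have : b ∈ A ∪ B := Or.inr hb
        rwa [hu] at this)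
      exact Set.notMem_empty b (hi ▸ ⟨hbA, hb⟩)
    rintro ⟨A, B, hu, hi, hA, hB, ho⟩
    have : φ ∈ A ∪ B := by rw [hu]; exact .refl
    rcases this with h | h
    · exact key A B hu hi hB ho h
    · exact key B A (by rw [Set.union_comm, hu]) (by rw [Set.inter_comm, hi]) hA
        (fun a ha b hb => by rw [real_inner_comm]; exact ho b hb a ha) h
  · rintro a ha b ⟨hb, hnb⟩
    by_contra h
    exact hnb (Relation.ReflTransGen.tail ha ⟨hb, h⟩)

/-- Two components of the same set are equal or orthogonal. -/
lemma component_eq_or_orthogonal {S C C' : Set V} (hC : IsComponent S C) (hC' : IsComponent S C') :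
    C = C' ∨ ∀ a ∈ C, ∀ b ∈ C', ⟪a, b⟫_ℝ = 0 := by
  have key : ∀ {C C' : Set V}, IsComponent S C → IsComponent S C' → ∀ x ∈ C, x ∈ C' → C ⊆ C' := by
    intro C C' hC hC' x hx hx'
    by_contra hn
    obtain ⟨y, hy, hy'⟩ := Set.not_subset.1 hn
    refine hC.2.1.2 ⟨C ∩ C', C \ C', Set.inter_union_sdiff C C', ?_, ⟨x, hx, hx'⟩, ⟨y, hy, hy'⟩, ?_⟩
    · ext z; simp only [Set.mem_inter_iff, Set.mem_sdiff, Set.mem_empty_iff_false]; tauto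
    · rintro a ⟨-, ha⟩ b ⟨hb, hb'⟩
      exact hC'.2.2 a ha b ⟨hC.1 hb, hb'⟩
  by_cases h : ∃ x ∈ C, x ∈ C'
  · obtain ⟨x, hx, hx'⟩ := h
    exact Or.inl ((key hC hC' x hx hx').antisymm (key hC' hC x hx' hx))
  · push Not at h
    refine Or.inr fun a ha b hb => hC.2.2 a ha b ⟨hC'.1 hb, fun hb' => h b hb' hb⟩

end Component

namespace RootSystemData

variable {V : Type*} [NormedAddCommGroup V] [InnerProductSpace ℝ V] {R : RootSystemData V}

lemma inner_eq_zero_of_support {x y : V}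
    (h : ∀ α ∈ (R.simpleBasis.repr x).support, ∀ β ∈ (R.simpleBasis.repr y).support,
      ⟪(α : V), (β : V)⟫_ℝ = 0) : ⟪x, y⟫_ℝ = 0 := by
  rw [R.inner_eq_sum]
  refine Finset.sum_eq_zero fun α hα => ?_
  beta_reduce
  rw [real_inner_comm, R.inner_eq_sum, Finsupp.sum, Finset.sum_eq_zero, mul_zero]
  intro β hβ
  rw [real_inner_comm, h α hα β hβ, mul_zero]

/-- Positive roots with disjoint supports, mutually orthogonal, do not add up to a root. -/
lemma add_notMem_of_orthogonal {x y : V} (hx : x ∈ R.Pos) (hy : y ∈ R.Pos)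
    (hd : Disjoint (R.simpleBasis.repr x).support (R.simpleBasis.repr y).support)
    (h : ⟪x, y⟫_ℝ = 0) : x + y ∉ R.Δ := by
  intro hxy
  have hyy := R.inner_self_pos (R.pos_subset hy)
  have key : ∀ {x y : V}, x ∈ R.Pos → y ∈ R.Pos →
      Disjoint (R.simpleBasis.repr x).support (R.simpleBasis.repr y).support →
      x - y ∉ R.Pos := by
    intro x y hx hy hd hP
    refine R.ne_zero_of_pos hy (R.simpleBasis.ext_elem fun α => ?_)
    by_contra hα
    rw [map_zero, Finsupp.zero_apply] at hα
    have hxα : R.simpleBasis.repr x α = 0 := by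
      by_contra h'
      exact Finset.disjoint_left.1 hd (Finsupp.mem_support_iff.2 h') (Finsupp.mem_support_iff.2 hα)
    have := R.repr_nonneg hP α
    rw [map_sub, Finsupp.sub_apply, hxα] at this
    exact hα (by linarith [R.repr_nonneg hy α])
  have hr : x - y ∈ R.Δ := by
    have := R.reflectRoot_mem hxy (R.pos_subset hy)
    rw [reflectRoot, inner_add_left, h, zero_add, mul_div_assoc, div_self hyy.ne'] at this
    convert this using 1
    module
  rcases R.mem_or_neg _ hr with h | h
  · exact key hx hy hd h
  · exact key hy hx hd.symm (by rwa [neg_sub] at h)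

/-- The support of a maximal positive root of a component contains the support of every root
of the component. -/
lemma support_subset_of_maximal {T : Set R.Simple} {C : Set V} (hC : IsComponent (R.levi T) C)
    {b : V} (hb : b ∈ C) (hbP : b ∈ R.Pos) (hdom : ∀ ψ ∈ C, ψ ∈ R.Pos → 0 ≤ ⟪b, ψ⟫_ℝ)
    {ψ : V} (hψ : ψ ∈ C) :
    (R.simpleBasis.repr ψ).support ⊆ (R.simpleBasis.repr b).support := by
  have horth : ∀ α : R.Simple, α ∈ (R.simpleBasis.repr b).support → ∀ β : R.Simple, (β : V) ∈ C →
      β ∉ (R.simpleBasis.repr b).support → ⟪(α : V), (β : V)⟫_ℝ = 0 := by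
    intro α hα β hβ hβb
    have hne : ∀ γ ∈ (R.simpleBasis.repr b).support, (γ : V) ≠ β := fun γ hγ h =>
      hβb (Subtype.ext h ▸ hγ)
    have hterm : ∀ γ ∈ (R.simpleBasis.repr b).support,
        R.simpleBasis.repr b γ * ⟪(γ : V), β⟫_ℝ ≤ 0 := fun γ hγ =>
      mul_nonpos_of_nonneg_of_nonpos (R.repr_nonneg hbP γ)
        (R.inner_simple_nonpos γ.2 β.2 (hne γ hγ))
    have h0 := hdom β hβ β.2.1
    rw [R.inner_eq_sum, Finsupp.sum] at h0
    have h1 := (Finset.sum_eq_zero_iff_of_nonpos hterm).1 (le_antisymm (Finset.sum_nonpos hterm) h0)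
      α hα
    exact (mul_eq_zero.1 h1).resolve_left (Finsupp.mem_support_iff.1 hα)
  have hdich : ∀ ψ ∈ R.Pos, ψ ∈ C →
      (R.simpleBasis.repr ψ).support ⊆ (R.simpleBasis.repr b).support ∨
      Disjoint (R.simpleBasis.repr b).support (R.simpleBasis.repr ψ).support := by
    classical
    have hmix : ∀ {x y : V}, x ∈ R.Pos → y ∈ R.Pos → y ∈ C → x + y ∈ R.Δ →
        (R.simpleBasis.repr x).support ⊆ (R.simpleBasis.repr b).support →
        Disjoint (R.simpleBasis.repr b).support (R.simpleBasis.repr y).support → False := by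
      intro x y hx hy hyC hxy hxs hys
      refine add_notMem_of_orthogonal hx hy (hys.mono_left hxs)
        (inner_eq_zero_of_support fun α hα β hβ => horth α (hxs hα) β ?_ ?_) hxy
      · exact simple_mem_component hC hy hyC (Finsupp.mem_support_iff.1 hβ)
      · exact fun h => Finset.disjoint_left.1 hys h hβ
    intro ψ hψ
    refine R.pos_induction (p := fun ψ => ψ ∈ C →
      (R.simpleBasis.repr ψ).support ⊆ (R.simpleBasis.repr b).support ∨
      Disjoint (R.simpleBasis.repr b).support (R.simpleBasis.repr ψ).support) ?_ ?_ hψ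
    · intro α hα _
      rw [R.repr_simple ⟨α, hα⟩, Finsupp.support_single _ one_ne_zero, Finset.singleton_subset_iff,
        Finset.disjoint_singleton_right]
      exact em _
    · intro x hx y hy h1 h2 hxy
      obtain ⟨hxC, hyC⟩ := component_split hC hx hy hxy
      have hxyΔ := (hC.1 hxy).1
      rcases h1 hxC with h1 | h1 <;> rcases h2 hyC with h2 | h2
      · left
        exact_mod_cast support_add_subset (T := ((R.simpleBasis.repr b).support : Set R.Simple))
          (by exact_mod_cast h1) (by exact_mod_cast h2)
      · exact (hmix hx hy hyC hxyΔ h1 h2).elim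
      · exact (hmix hy hx hxC (by rwa [add_comm]) h2 h1).elim
      · right
        rw [map_add]
        exact (Finset.disjoint_union_right.2 ⟨h1, h2⟩).mono_right Finsupp.support_add
  have hdich' : ∀ ψ ∈ C,
      (R.simpleBasis.repr ψ).support ⊆ (R.simpleBasis.repr b).support ∨
      Disjoint (R.simpleBasis.repr b).support (R.simpleBasis.repr ψ).support := by
    intro ψ hψ
    rcases R.mem_or_neg ψ (hC.1 hψ).1 with h | h
    · exact hdich ψ h hψ
    · have := hdich _ h (component_neg hC hψ)
      rwa [map_neg, Finsupp.support_neg] at this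
  by_contra hn
  refine hC.2.1.2
    ⟨{x ∈ C | (R.simpleBasis.repr x).support ⊆ (R.simpleBasis.repr b).support},
      {x ∈ C | ¬ (R.simpleBasis.repr x).support ⊆ (R.simpleBasis.repr b).support},
      ?_, ?_, ⟨b, hb, subset_rfl⟩, ⟨ψ, hψ, hn⟩, ?_⟩
  · ext x; simp only [Set.mem_union, Set.mem_ofPred_eq]; tauto
  · ext x; simp only [Set.mem_inter_iff, Set.mem_ofPred_eq, Set.mem_empty_iff_false]; tauto
  · rintro x ⟨hx, hxs⟩ y ⟨hy, hys⟩
    have hd := (hdich' y hy).resolve_left hys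
    refine inner_eq_zero_of_support fun α hα β hβ => horth α (hxs hα) β ?_
      fun h => Finset.disjoint_left.1 hd h hβ
    rcases R.mem_or_neg y (hC.1 hy).1 with h | h
    · exact simple_mem_component hC h hy (Finsupp.mem_support_iff.1 hβ)
    · refine simple_mem_component hC h (component_neg hC hy) ?_
      rw [map_neg, Finsupp.neg_apply]
      exact neg_ne_zero.2 (Finsupp.mem_support_iff.1 hβ)

/-- Every irreducible component of a Levi subsystem has a highest root. -/
lemma exists_highest {T : Set R.Simple} {C : Set V} (hC : IsComponent (R.levi T) C) :
    ∃ b, R.IsHighest C b := by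
  have hfin : C.Finite := R.finite.subset fun x hx => (hC.1 hx).1
  have hne : (C ∩ R.Pos).Nonempty := by
    obtain ⟨x, hx⟩ := hC.2.1.1
    rcases R.mem_or_neg x (hC.1 hx).1 with h | h
    · exact ⟨x, hx, h⟩
    · exact ⟨-x, component_neg hC hx, h⟩
  obtain ⟨b, ⟨hbC, hbP⟩, hmax⟩ :=
    Set.exists_max_image (C ∩ R.Pos) R.htForm (hfin.subset Set.inter_subset_left) hne
  have hdom : ∀ ψ ∈ C, ψ ∈ R.Pos → 0 ≤ ⟪b, ψ⟫_ℝ := by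
    intro ψ hψ hψP
    by_contra! h
    have hs := R.add_mem (R.pos_subset hbP) (R.pos_subset hψP) h (R.pos_add_ne_zero hbP hψP)
    have := hmax _ ⟨component_add hC hbC hψ hs, R.pos_add b hbP ψ hψP hs⟩
    rw [map_add] at this
    linarith [R.htForm_pos hψP]
  refine ⟨b, hbC, hbP, fun ψ hψ => ?_⟩
  obtain ⟨χ, ⟨hχC, hχ⟩, hχmax⟩ := Set.exists_max_image {χ ∈ C | R.NonnegComb (χ - ψ)} R.htForm
    (hfin.subset fun x hx => hx.1) ⟨ψ, hψ, by rw [sub_self]; exact R.nonnegComb_zero⟩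
  suffices hbχ : R.NonnegComb (b - χ) by
    have := NonnegComb.add R hbχ hχ
    rwa [sub_add_sub_cancel] at this
  rcases R.mem_or_neg χ (hC.1 hχC).1 with hχP | hχP
  · by_cases hbeq : b = χ
    · rw [hbeq, sub_self]; exact R.nonnegComb_zero
    have hχdom : ∀ α : V, α ∈ C → α ∈ R.Pos → 0 ≤ ⟪α, χ⟫_ℝ := by
      intro α hα hαP
      by_contra! h
      rw [real_inner_comm] at h
      have hs := R.add_mem (R.pos_subset hχP) (R.pos_subset hαP) h (R.pos_add_ne_zero hχP hαP)
      have := hχmax (χ + α) ⟨component_add hC hχC hα hs, by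
        rw [add_sub_right_comm]; exact NonnegComb.add R hχ (R.nonnegComb_of_pos hαP)⟩
      rw [map_add] at this
      linarith [R.htForm_pos hαP]
    have hterm : ∀ α ∈ (R.simpleBasis.repr b).support,
        0 ≤ R.simpleBasis.repr b α * ⟪(α : V), χ⟫_ℝ := fun α hα =>
      mul_nonneg (R.repr_nonneg hbP α) (hχdom α
        (simple_mem_component hC hbP hbC (Finsupp.mem_support_iff.1 hα)) α.2.1)
    have hpos : 0 < ⟪b, χ⟫_ℝ := by
      refine lt_of_le_of_ne' (hχdom b hbC hbP) fun h0 => ?_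
      rw [R.inner_eq_sum, Finsupp.sum, Finset.sum_eq_zero_iff_of_nonneg hterm] at h0
      have : ⟪χ, χ⟫_ℝ = 0 := by
        rw [R.inner_eq_sum]
        refine Finset.sum_eq_zero fun α hα => ?_
        have hαb := support_subset_of_maximal hC hbC hbP hdom hχC hα
        beta_reduce
        rw [(mul_eq_zero.1 (h0 α hαb)).resolve_left (Finsupp.mem_support_iff.1 hαb), mul_zero]
      linarith [R.inner_self_pos (R.pos_subset hχP)]
    rcases R.mem_or_neg _ (R.sub_mem (R.pos_subset hbP) (R.pos_subset hχP) hpos hbeq) with h | h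
    · exact R.nonnegComb_of_pos h
    · have h1 := R.htForm_pos h
      rw [neg_sub, map_sub] at h1
      linarith [hmax χ ⟨hχC, hχP⟩]
  · rw [sub_eq_add_neg]
    exact NonnegComb.add R (R.nonnegComb_of_pos hbP) (R.nonnegComb_of_pos hχP)

lemma IsHighest.unique {S : Set V} {b c : V} (hb : R.IsHighest S b) (hc : R.IsHighest S c) :
    b = c := by
  refine sub_eq_zero.1 (R.eq_zero_of_repr_nonneg
    (R.repr_nonneg_of_nonnegComb (hb.2.2 c hc.1)) ?_)
  rw [neg_sub]
  exact R.repr_nonneg_of_nonnegComb (hc.2.2 b hb.1)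

variable (R) in
/-- The roots reachable from the set of roots `S` by a chain cascade starting in `S`. -/
inductive Reach : Set V → V → Prop
  | base {S C : Set V} {b : V} : IsComponent S C → R.IsHighest C b → Reach S b
  | step {S C : Set V} {b β : V} : IsComponent S C → R.IsHighest C b → Reach (R.orth b) β →
      Reach S β

lemma reach_of_mem_chain {S : Set V} {l : List V}
    (hhead : ∀ b ∈ l.head?, ∃ C, IsComponent S C ∧ R.IsHighest C b)
    (hchain : l.IsChain fun γ δ => ∃ C, IsComponent (R.orth γ) C ∧ R.IsHighest C δ)
    {β : V} (hβ : β ∈ l) : R.Reach S β := by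
  induction l generalizing S with
  | nil => simp at hβ
  | cons b l ih =>
    obtain ⟨C, hC, hb⟩ := hhead b (by simp)
    rw [List.isChain_cons] at hchain
    rcases List.mem_cons.1 hβ with rfl | hβ
    · exact .base hC hb
    · exact .step hC hb (ih hchain.1 hchain.2 hβ)

lemma exists_chain_of_reach {S : Set V} {β : V} (h : R.Reach S β) :
    ∃ l : List V, (∀ b ∈ l.head?, ∃ C, IsComponent S C ∧ R.IsHighest C b) ∧
      (l.IsChain fun γ δ => ∃ C, IsComponent (R.orth γ) C ∧ R.IsHighest C δ) ∧ β ∈ l := by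
  induction h with
  | @base S C b hC hb => exact ⟨[b], by simpa using ⟨C, hC, hb⟩, by simp, by simp⟩
  | @step S C b β hC hb _ ih =>
    obtain ⟨l, h1, h2, h3⟩ := ih
    exact ⟨b :: l, by simpa using ⟨C, hC, hb⟩, List.isChain_cons.2 ⟨h1, h2⟩, by simp [h3]⟩

lemma mem_cascade_iff {β : V} : β ∈ R.cascade ↔ R.Reach R.Δ β := by
  constructor
  · rintro ⟨l, ⟨-, h1, h2⟩, hβ⟩
    exact reach_of_mem_chain h1 h2 hβ
  · intro h
    obtain ⟨l, h1, h2, h3⟩ := exists_chain_of_reach h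
    exact ⟨l, ⟨List.ne_nil_of_mem h3, h1, h2⟩, h3⟩

/-- The component of a Levi subsystem below its highest root `b`: the data needed to continue
a cascade inside `Δ(b)°`. -/
lemma levi_step {T : Set R.Simple} {C : Set V} (hC : IsComponent (R.levi T) C) {b : V}
    (hb : R.IsHighest C b) : C = R.sub b ∧ R.IsHighest (R.sub b) b ∧
      ∃ T' : Set R.Simple, R.orth b = R.levi T' := by
  have h := component_eq_sub hC hb
  have hb' : R.IsHighest (R.sub b) b := h ▸ hb
  exact ⟨h, hb', _, orth_eq_levi hb'⟩

lemma reach_highest {S : Set V} {β : V} (h : R.Reach S β) :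
    ∀ T : Set R.Simple, S = R.levi T → R.IsHighest (R.sub β) β ∧ R.sub β ⊆ S := by
  induction h with
  | base hC hb =>
    rintro T rfl
    obtain ⟨h1, h2, -⟩ := levi_step hC hb
    exact ⟨h2, h1 ▸ hC.1⟩
  | step hC hb _ ih =>
    rintro T rfl
    obtain ⟨h1, h2, T', hT'⟩ := levi_step hC hb
    obtain ⟨h3, h4⟩ := ih T' hT'
    exact ⟨h3, h4.trans fun x hx => hC.1 (h1 ▸ hx.1)⟩

/-- A root `ψ` in both `Δ(β)` and `Δ(β')`, orthogonal to neither `β` nor `β'`, forces `β = β'`. -/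
lemma reach_unique {S : Set V} {β : V} (h : R.Reach S β) :
    ∀ T : Set R.Simple, S = R.levi T → ∀ β', R.Reach S β' →
      ∀ ψ, ψ ∈ R.sub β → ψ ∈ R.sub β' → ⟪ψ, β⟫_ℝ ≠ 0 → ⟪ψ, β'⟫_ℝ ≠ 0 → β = β' := by
  have hcomp : ∀ {T : Set R.Simple} {C C' : Set V} {b b' ψ : V}, IsComponent (R.levi T) C →
      IsComponent (R.levi T) C' → R.IsHighest C b → R.IsHighest C' b' → ψ ∈ R.sub b →
      ψ ∈ R.sub b' → b = b' := by
    intro T C C' b b' ψ hC hC' hb hb' hψ hψ'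
    rw [← component_eq_sub hC hb] at hψ
    rw [← component_eq_sub hC' hb'] at hψ'
    rcases component_eq_or_orthogonal hC hC' with rfl | h0
    · exact hb.unique hb'
    · linarith [h0 ψ hψ ψ hψ', R.inner_self_pos (hC.1 hψ).1]
  induction h with
  | base hC hb =>
    rintro T rfl β' h' ψ hψ hψ' h1 h2
    cases h' with
    | base hC' hb' => exact hcomp hC hC' hb hb' hψ hψ'
    | step hC' hb' hr =>
      obtain ⟨-, -, T', hT'⟩ := levi_step hC' hb'
      have hψo := (reach_highest hr T' hT').2 hψ'
      obtain rfl := hcomp hC hC' hb hb' hψ hψo.1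
      exact absurd hψo.2 h1
  | step hC hb hr ih =>
    rintro T rfl β' h' ψ hψ hψ' h1 h2
    obtain ⟨-, -, T', hT'⟩ := levi_step hC hb
    have hψo := (reach_highest hr T' hT').2 hψ
    cases h' with
    | base hC' hb' =>
      obtain rfl := hcomp hC hC' hb hb' hψo.1 hψ'
      exact absurd hψo.2 h2
    | step hC' hb' hr' =>
      obtain ⟨-, -, T'', hT''⟩ := levi_step hC' hb'
      have hψo' := (reach_highest hr' T'' hT'').2 hψ'
      obtain rfl := hcomp hC hC' hb hb' hψo.1 hψo'.1
      exact ih T' hT' _ hr' ψ hψ hψ' h1 h2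

lemma reach_orthogonal {S : Set V} {β : V} (h : R.Reach S β) :
    ∀ T : Set R.Simple, S = R.levi T → ∀ β', R.Reach S β' → β ≠ β' → ⟪β, β'⟫_ℝ = 0 := by
  have hself : ∀ {S : Set V} {β : V} {T : Set R.Simple}, R.Reach S β → S = R.levi T → β ∈ S :=
    fun h hT => (reach_highest h _ hT).2 (reach_highest h _ hT).1.1
  have hcomp : ∀ {T : Set R.Simple} {C C' : Set V} {b b' x y : V}, IsComponent (R.levi T) C →
      IsComponent (R.levi T) C' → R.IsHighest C b → R.IsHighest C' b' → x ∈ R.sub b →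
      y ∈ R.sub b' → b = b' ∨ ⟪x, y⟫_ℝ = 0 := by
    intro T C C' b b' x y hC hC' hb hb' hx hy
    rw [← component_eq_sub hC hb] at hx
    rw [← component_eq_sub hC' hb'] at hy
    rcases component_eq_or_orthogonal hC hC' with rfl | h0
    · exact Or.inl (hb.unique hb')
    · exact Or.inr (h0 x hx y hy)
  induction h with
  | base hC hb =>
    rintro T rfl β' h' hne
    have hbs := (levi_step hC hb).2.1.1
    cases h' with
    | base hC' hb' => exact (hcomp hC hC' hb hb' hbs (levi_step hC' hb').2.1.1).resolve_left hne
    | step hC' hb' hr =>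
      obtain ⟨-, -, T', hT'⟩ := levi_step hC' hb'
      have ho := hself hr hT'
      rcases hcomp hC hC' hb hb' hbs ho.1 with rfl | h0
      · rw [real_inner_comm]; exact ho.2
      · exact h0
  | step hC hb hr ih =>
    rintro T rfl β' h' hne
    obtain ⟨-, -, T', hT'⟩ := levi_step hC hb
    have ho := hself hr hT'
    cases h' with
    | base hC' hb' =>
      rcases hcomp hC hC' hb hb' ho.1 (levi_step hC' hb').2.1.1 with rfl | h0
      · exact ho.2
      · exact h0
    | step hC' hb' hr' =>
      obtain ⟨-, -, T'', hT''⟩ := levi_step hC' hb'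
      have ho' := hself hr' hT''
      rcases hcomp hC hC' hb hb' ho.1 ho'.1 with rfl | h0
      · exact ih T' hT' _ hr' hne
      · exact h0

lemma exists_reach {φ : V} (hφ : φ ∈ R.Pos) (T : Set R.Simple) (hT : φ ∈ R.levi T) :
    ∃ β, R.Reach (R.levi T) β ∧ φ ∈ R.sub β ∧ 0 < ⟪φ, β⟫_ℝ := by
  induction hn : (R.levi T).ncard using Nat.strong_induction_on generalizing T with
  | _ n ih =>
    obtain ⟨C, hC, hφC⟩ := exists_component hT
    obtain ⟨b, hb⟩ := exists_highest hC
    obtain ⟨h1, h2, T', hT'⟩ := levi_step hC hb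
    rw [h1] at hφC
    rcases (inner_nonneg_of_highest h2 hφC hφ).eq_or_lt with h0 | h0
    · have hss : R.levi T' ⊂ R.levi T := by
        rw [← hT']
        refine ⟨fun x hx => hC.1 (h1 ▸ hx.1), fun hsub => ?_⟩
        have := (hsub (hC.1 hb.1)).2
        linarith [R.inner_self_pos (R.pos_subset hb.2.1)]
      obtain ⟨β, hβ, hφβ⟩ := ih _ (hn ▸ Set.ncard_lt_ncard hss (R.finite.subset fun x hx => hx.1))
        T' (hT' ▸ ⟨hφC, h0.symm⟩) rfl
      exact ⟨β, .step hC hb (hT' ▸ hβ), hφβ⟩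
    · exact ⟨b, .base hC hb, hφC, h0⟩

lemma cascade_highest {β : V} (hβ : β ∈ R.cascade) : R.IsHighest (R.sub β) β :=
  (reach_highest (mem_cascade_iff.1 hβ) Set.univ R.levi_univ.symm).1

lemma cascade_subset_pos : R.cascade ⊆ R.Pos := fun _ hβ => (cascade_highest hβ).2.1

lemma cascade_orthogonal {β γ : V} (hβ : β ∈ R.cascade) (hγ : γ ∈ R.cascade) (h : β ≠ γ) :
    ⟪β, γ⟫_ℝ = 0 :=
  reach_orthogonal (mem_cascade_iff.1 hβ) Set.univ R.levi_univ.symm γ (mem_cascade_iff.1 hγ) h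

/-- Every positive root outside the cascade is completed to a cascade root by a positive root. -/
lemma exists_cascade_sub_pos {φ : V} (hφ : φ ∈ R.Pos) (hn : φ ∉ R.cascade) :
    ∃ β ∈ R.cascade, β - φ ∈ R.Pos := by
  obtain ⟨β, hβ, hφβ, h0⟩ := exists_reach hφ Set.univ (R.levi_univ ▸ R.pos_subset hφ)
  rw [levi_univ, ← mem_cascade_iff] at hβ
  have hh := cascade_highest hβ
  refine ⟨β, hβ, ?_⟩
  rw [real_inner_comm] at h0
  have hd := R.sub_mem (R.pos_subset hh.2.1) (R.pos_subset hφ) h0 (fun h => hn (h ▸ hβ))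
  refine (R.mem_or_neg _ hd).resolve_right fun h => R.ne_zero_of_pos h ?_
  exact R.eq_zero_of_repr_nonneg (R.repr_nonneg h)
    (by rw [neg_neg]; exact R.repr_nonneg_of_nonnegComb (hh.2.2 φ hφβ))

lemma mem_sub_and_inner_pos {β ψ : V} (hβ : R.IsHighest (R.sub β) β) (hψ : ψ ∈ R.Pos)
    (h : β - ψ ∈ R.Pos) : ψ ∈ R.sub β ∧ 0 < ⟪ψ, β⟫_ℝ := by
  have hself := hβ.1
  have hsub : ψ ∈ R.sub β ∧ β - ψ ∈ R.sub β := by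
    rw [sub_eq_levi] at hself ⊢
    exact mem_levi_of_add_mem_levi hψ h (by rwa [add_sub_cancel])
  refine ⟨hsub.1, (inner_nonneg_of_highest hβ hsub.1 hψ).lt_of_ne' fun h0 => ?_⟩
  have hββ := R.inner_self_pos (R.pos_subset hβ.2.1)
  have hr := R.neg_mem _ (R.reflectRoot_mem (R.pos_subset h) (R.pos_subset hβ.2.1))
  rw [reflectRoot, inner_sub_left, h0, sub_zero, mul_div_assoc, div_self hββ.ne'] at hr
  refine not_highest_add hβ hsub.1 hψ ?_
  convert hr using 1
  module

/-- A positive root is completed to at most one cascade root by a positive root. -/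
lemma cascade_sub_pos_unique {β β' ψ : V} (hβ : β ∈ R.cascade) (hβ' : β' ∈ R.cascade)
    (hψ : ψ ∈ R.Pos) (h : β - ψ ∈ R.Pos) (h' : β' - ψ ∈ R.Pos) : β = β' := by
  obtain ⟨h1, h2⟩ := mem_sub_and_inner_pos (cascade_highest hβ) hψ h
  obtain ⟨h3, h4⟩ := mem_sub_and_inner_pos (cascade_highest hβ') hψ h'
  exact reach_unique (mem_cascade_iff.1 hβ) Set.univ R.levi_univ.symm β' (mem_cascade_iff.1 hβ')
    ψ h1 h3 h2.ne' h4.ne'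

end RootSystemData

/-! ### Derivations of polynomial rings -/

section Derivations

open MvPolynomial

variable {σ : Type*}

lemma derivation_apply_eq_sum_pderiv [Fintype σ]
    (D : Derivation ℂ (MvPolynomial σ ℂ) (MvPolynomial σ ℂ)) (f : MvPolynomial σ ℂ) :
    D f = ∑ i, pderiv i f * D (X i) := by
  classical
  have hsum : ∀ (E : σ → Derivation ℂ (MvPolynomial σ ℂ) (MvPolynomial σ ℂ))
      (g : MvPolynomial σ ℂ), (∑ i, E i) g = ∑ i, E i g := fun E g => by
    rw [← Derivation.coeFnAddMonoidHom_apply, map_sum, Finset.sum_apply]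
    rfl
  have : D = ∑ i, D (X i) • pderiv (R := ℂ) (σ := σ) i := by
    refine derivation_ext fun j => ?_
    simp [hsum, pderiv_X, Pi.single_apply]
  conv_lhs => rw [this]
  simp [hsum, mul_comm]

lemma coeff_pderiv_mul_C_mul_X [DecidableEq σ] (f : MvPolynomial σ ℂ) (i j : σ) (c : ℂ)
    (e : σ →₀ ℕ) :
    coeff (e + Finsupp.single j 1) (pderiv i f * (C c * X j)) =
      c * (coeff (e + Finsupp.single i 1) f * (e i + 1)) := by
  rw [mul_left_comm, coeff_C_mul, coeff_mul_X, coeff_pderiv]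

/-- Eigenvalue of a diagonal derivation on monomials. -/
lemma coeff_derivation_diagonal [Fintype σ]
    (D : Derivation ℂ (MvPolynomial σ ℂ) (MvPolynomial σ ℂ))
    (a : σ → ℂ) (hD : ∀ i, D (X i) = C (a i) * X i) (f : MvPolynomial σ ℂ) (d : σ →₀ ℕ) :
    coeff d (D f) = (∑ i, d i * a i) * coeff d f := by
  classical
  rw [derivation_apply_eq_sum_pderiv, coeff_sum, Finset.sum_mul]
  refine Finset.sum_congr rfl fun i _ => ?_
  rw [hD]
  by_cases hi : d i = 0
  · rw [← mul_assoc, coeff_mul_X', if_neg (by simpa using hi), hi]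
    simp
  · obtain ⟨e, rfl⟩ : ∃ e, d = e + Finsupp.single i 1 :=
      ⟨d - Finsupp.single i 1, (tsub_add_cancel_of_le (by simpa [Nat.one_le_iff_ne_zero])).symm⟩
    rw [coeff_pderiv_mul_C_mul_X]
    simp only [Finsupp.add_apply, Finsupp.single_eq_same]
    push_cast
    ring

/-- If every variable outside `B` can be moved into `B` by a monomial derivation killing `f`, which
moves no other variable from outside `B` into `B`, then in each degree in which `f` has a monomial
it has a monomial in the variables of `B`. -/
lemma exists_monomial_supported [Fintype σ] (B : Set σ) (f : MvPolynomial σ ℂ)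
    (h : ∀ φ ∉ B, ∃ D : Derivation ℂ (MvPolynomial σ ℂ) (MvPolynomial σ ℂ), D f = 0 ∧
      ∃ (c : σ → ℂ) (g : σ → σ), (∀ i, D (X i) = C (c i) * X (g i)) ∧ c φ ≠ 0 ∧ g φ ∈ B ∧
        ∀ i, c i ≠ 0 → i ∉ B → g i ∈ B → i = φ)
    {d : σ →₀ ℕ} (hd : d ∈ f.support) :
    ∃ d₀ ∈ f.support, d₀.degree = d.degree ∧ ∀ i ∉ B, d₀ i = 0 := by
  classical
  let w : (σ →₀ ℕ) → ℕ := fun d => ∑ i, if i ∈ B then 0 else d i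
  have hw : ∀ (e : σ →₀ ℕ) (i : σ),
      w (e + Finsupp.single i 1) = w e + if i ∈ B then 0 else 1 := by
    intro e i
    have : ∀ j, (if j ∈ B then 0 else (e + Finsupp.single i 1 : σ →₀ ℕ) j) =
        (if j ∈ B then 0 else e j) + if j = i then (if i ∈ B then 0 else 1) else 0 := by
      intro j
      rw [Finsupp.add_apply, Finsupp.single_apply]
      by_cases hij : i = j
      · subst hij; by_cases hi : i ∈ B <;> simp [hi]
      · simp [hij, Ne.symm hij]
    simp only [w, this, Finset.sum_add_distrib, Finset.sum_ite_eq', Finset.mem_univ, if_true]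
  obtain ⟨d₀, hd₀, hmin⟩ := Finset.exists_min_image (f.support.filter fun e => e.degree = d.degree) w
    ⟨d, by simp only [Finset.mem_filter]; exact ⟨hd, trivial⟩⟩
  simp only [Finset.mem_filter, and_imp] at hd₀ hmin
  refine ⟨d₀, hd₀.1, hd₀.2, fun φ hφ => ?_⟩
  by_contra hne
  obtain ⟨D, hDf, c, g, hD, hc, hg, huniq⟩ := h φ hφ
  obtain ⟨e, rfl⟩ : ∃ e, d₀ = e + Finsupp.single φ 1 :=
    ⟨d₀ - Finsupp.single φ 1, (tsub_add_cancel_of_le (by simpa [Nat.one_le_iff_ne_zero])).symm⟩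
  have hcoeff : coeff (e + Finsupp.single (g φ) 1) (D f) = 0 := by rw [hDf, coeff_zero]
  rw [derivation_apply_eq_sum_pderiv, coeff_sum, Finset.sum_eq_single φ] at hcoeff
  · rw [hD, coeff_pderiv_mul_C_mul_X] at hcoeff
    have h1 : coeff (e + Finsupp.single φ 1) f ≠ 0 := mem_support_iff.1 hd₀.1
    have h2 : (e φ : ℂ) + 1 ≠ 0 := by exact_mod_cast Nat.succ_ne_zero (e φ)
    exact mul_ne_zero hc (mul_ne_zero h1 h2) hcoeff
  · intro i _ hi
    rw [hD]
    by_cases hci : c i = 0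
    · simp [hci]
    by_cases hgi : (e + Finsupp.single (g φ) 1 : σ →₀ ℕ) (g i) = 0
    · rw [← mul_assoc, coeff_mul_X', if_neg (by simpa using hgi)]
    obtain ⟨e', he'⟩ : ∃ e', e + Finsupp.single (g φ) 1 = e' + Finsupp.single (g i) 1 :=
      ⟨e + Finsupp.single (g φ) 1 - Finsupp.single (g i) 1,
        (tsub_add_cancel_of_le (Finsupp.single_le_iff.2 (Nat.one_le_iff_ne_zero.2 hgi))).symm⟩
    rw [he', coeff_pderiv_mul_C_mul_X]
    by_cases h0 : coeff (e' + Finsupp.single i 1) f = 0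
    · rw [h0]; simp
    have hdeg := congrArg Finsupp.degree he'
    have hdeg0 := hd₀.2
    simp only [map_add, Finsupp.degree_single] at hdeg hdeg0
    have hle := hmin _ (mem_support_iff.2 h0) (by
      simp only [map_add, Finsupp.degree_single]; omega)
    have hwe := congrArg w he'
    rw [hw, hw, if_pos hg] at hwe
    rw [hw, hw, if_neg hφ] at hle
    by_cases hiB : i ∈ B
    · rw [if_pos hiB] at hle; omega
    by_cases hgB : g i ∈ B
    · exact absurd (huniq i hci hiB hgB) hi
    · rw [if_neg hiB] at hle; rw [if_neg hgB] at hwe; omega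
  · simp

end Derivations

namespace CascadeLieData

open MvPolynomial

variable {V : Type*} [NormedAddCommGroup V] [InnerProductSpace ℝ V]
  {L : Type*} [LieRing L] [LieAlgebra ℂ L]
  (C : CascadeLieData V L)

lemma e_mem_nSub (φ : C.Pos) : C.e φ ∈ C.nSub := Submodule.subset_span ⟨φ, φ.2, rfl⟩

/-- Bracketing with a positive root vector is a monomial operation on positive root vectors. -/
lemma exists_lie_e_eq {ψ : V} (hψ : ψ ∈ C.Pos) (i : C.Pos) :
    ∃ (c : ℂ) (j : C.Pos), ⁅C.e ψ, C.e i⁆ = c • C.e j ∧ (c ≠ 0 → (j : V) = ψ + i) ∧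
      (ψ + i ∈ C.Pos → c ≠ 0) := by
  have hψΔ := C.pos_subset hψ
  have hiΔ := C.pos_subset i.2
  by_cases h : ψ + i ∈ C.Δ
  · obtain ⟨c, hc, hb⟩ := C.bracket_add ψ hψΔ i hiΔ h
    exact ⟨c, ⟨ψ + i, C.pos_add ψ hψ i i.2 h⟩, hb, fun _ => rfl, fun _ => hc⟩
  · refine ⟨0, i, ?_, fun h0 => absurd rfl h0, fun h' => absurd (C.pos_subset h') h⟩
    rw [zero_smul]
    exact C.bracket_zero ψ hψΔ i hiΔ h (C.toRootSystemData.pos_add_ne_zero hψ i.2)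

lemma killingForm_e_neg_eq_zero (φ : C.Pos) {β : V} (hβ : β ∈ C.Δ) (h : (φ : V) ≠ β) :
    killingForm ℂ L (C.e φ) (C.e (-β)) = 0 :=
  C.killing_orth φ (C.pos_subset φ.2) (-β) (C.neg_mem β hβ)
    (by rwa [← sub_eq_add_neg, sub_ne_zero])

variable {C}

/-- In each degree in which an `𝔫`-invariant has a monomial, it has a monomial in the variables
indexed by the cascade. -/
lemma exists_cascade_monomial [Fintype C.Pos] {ι : L →ₗ[ℂ] MvPolynomial (↥C.Pos) ℂ}
    (hι : ∀ φ : ↥C.Pos, ι (C.e φ) = X φ)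
    {Dn : L → Derivation ℂ (MvPolynomial (↥C.Pos) ℂ) (MvPolynomial (↥C.Pos) ℂ)}
    (hDn : ∀ v ∈ C.nSub, ∀ w ∈ C.nSub, Dn v (ι w) = ι ⁅v, w⁆)
    {ξ : MvPolynomial (↥C.Pos) ℂ} (hinv : ∀ v ∈ C.nSub, Dn v ξ = 0)
    {d : ↥C.Pos →₀ ℕ} (hd : d ∈ ξ.support) :
    ∃ d₀ ∈ ξ.support, d₀.degree = d.degree ∧
      ∀ i : C.Pos, (i : V) ∉ C.toRootSystemData.cascade → d₀ i = 0 := by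
  refine exists_monomial_supported {i : C.Pos | (i : V) ∈ C.toRootSystemData.cascade} ξ ?_ hd
  intro φ hφ
  obtain ⟨β, hβ, hψ⟩ := RootSystemData.exists_cascade_sub_pos φ.2 hφ
  have hβP := RootSystemData.cascade_subset_pos hβ
  choose c g hcg hg hc using C.exists_lie_e_eq hψ
  have hcφ : c φ ≠ 0 := hc φ (by rwa [sub_add_cancel])
  refine ⟨Dn (C.e (β - φ)), hinv _ (C.e_mem_nSub ⟨_, hψ⟩), c, g, fun i => ?_, hcφ, ?_, ?_⟩
  · rw [← hι, hDn _ (C.e_mem_nSub ⟨_, hψ⟩) _ (C.e_mem_nSub i), hcg, map_smul, hι, smul_eq_C_mul]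
  · change (g φ : V) ∈ C.toRootSystemData.cascade
    rwa [hg φ hcφ, sub_add_cancel]
  · intro i hci _ hgi
    have hgi' : (g i : V) ∈ C.toRootSystemData.cascade := hgi
    rw [hg i hci] at hgi'
    have := RootSystemData.cascade_sub_pos_unique hβ hgi' hψ (by rw [sub_sub_cancel]; exact φ.2)
      (by rw [add_sub_cancel_left]; exact i.2)
    refine Subtype.ext ?_
    rw [sub_add_eq_add_sub, eq_sub_iff_add_eq, add_right_inj] at this
    exact this.symm

/-- All monomials of a weight vector of weight `ν` have weight `ν`. -/
lemma sum_smul_eq_weight [Fintype C.Pos] {ι : L →ₗ[ℂ] MvPolynomial (↥C.Pos) ℂ}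
    (hι : ∀ φ : ↥C.Pos, ι (C.e φ) = X φ)
    {Dh : C.H → Derivation ℂ (MvPolynomial (↥C.Pos) ℂ) (MvPolynomial (↥C.Pos) ℂ)}
    (hDh : ∀ x : C.H, ∀ w ∈ C.nSub, Dh x (ι w) = ι ⁅(x : L), w⁆)
    {ν : V} {ξ : MvPolynomial (↥C.Pos) ℂ} (hwt : ∀ x : C.H, Dh x ξ = C.wt ν x • ξ)
    {d : ↥C.Pos →₀ ℕ} (hd : d ∈ ξ.support) : ∑ i, d i • (i : V) = ν := by
  refine C.wt_inj (LinearMap.ext fun x => ?_)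
  have h1 := coeff_derivation_diagonal (Dh x) (fun i => C.wt i x) (fun i => by
    rw [← hι, hDh x _ (C.e_mem_nSub i), C.root_vec x i (C.pos_subset i.2), map_smul, hι,
      smul_eq_C_mul]) ξ d
  rw [hwt, coeff_smul, smul_eq_mul] at h1
  rw [mul_right_cancel₀ (mem_support_iff.1 hd) h1]
  simp [LinearMap.sum_apply]

/-- A monomial of weight `ν` in the cascade variables has exponents `(ν,β)/(β,β)`. -/
lemma exponent_eq [Fintype C.Pos] {ν : V} {d : ↥C.Pos →₀ ℕ} (hd : ∑ i, d i • (i : V) = ν)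
    (hsupp : ∀ i : C.Pos, (i : V) ∉ C.toRootSystemData.cascade → d i = 0)
    {β : C.Pos} (hβ : (β : V) ∈ C.toRootSystemData.cascade) :
    (d β : ℝ) = ⟪ν, (β : V)⟫_ℝ / ⟪(β : V), (β : V)⟫_ℝ := by
  have hpos := C.toRootSystemData.inner_self_pos (C.pos_subset β.2)
  rw [eq_div_iff hpos.ne', ← hd, sum_inner, Finset.sum_eq_single β]
  · rw [← Nat.cast_smul_eq_nsmul ℝ, real_inner_smul_left]
  · intro i _ hi
    by_cases hic : (i : V) ∈ C.toRootSystemData.cascade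
    · rw [← Nat.cast_smul_eq_nsmul ℝ, real_inner_smul_left,
        RootSystemData.cascade_orthogonal hic hβ (fun h => hi (Subtype.ext h)), mul_zero]
    · rw [hsupp i hic, zero_smul, inner_zero_left]
  · simp

/-- The Killing form pairing of a positive root vector with an element of `𝔯₋`. -/
lemma killingForm_e_sum_of_mem {φ : C.Pos} (hφ : (φ : V) ∈ C.toRootSystemData.cascade) (t : V → ℂ) :
    killingForm ℂ L (C.e φ) (∑ᶠ β ∈ C.toRootSystemData.cascade, t β • C.e (-β)) =
      t φ * killingForm ℂ L (C.e φ) (C.e (-φ)) := by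
  have hfin : (C.toRootSystemData.cascade).Finite :=
    C.toRootSystemData.pos_finite.subset RootSystemData.cascade_subset_pos
  rw [finsum_mem_eq_finite_toFinset_sum _ hfin, map_sum, Finset.sum_eq_single (φ : V)]
  · rw [map_smul, smul_eq_mul]
  · intro β hβ hne
    rw [map_smul, C.killingForm_e_neg_eq_zero φ
      (C.pos_subset (RootSystemData.cascade_subset_pos (hfin.mem_toFinset.1 hβ))) hne.symm,
      smul_zero]
  · exact fun h => absurd (hfin.mem_toFinset.2 hφ) h

lemma killingForm_e_sum_of_notMem {φ : C.Pos} (hφ : (φ : V) ∉ C.toRootSystemData.cascade)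
    (t : V → ℂ) :
    killingForm ℂ L (C.e φ) (∑ᶠ β ∈ C.toRootSystemData.cascade, t β • C.e (-β)) = 0 := by
  have hfin : (C.toRootSystemData.cascade).Finite :=
    C.toRootSystemData.pos_finite.subset RootSystemData.cascade_subset_pos
  rw [finsum_mem_eq_finite_toFinset_sum _ hfin, map_sum]
  refine Finset.sum_eq_zero fun β hβ => ?_
  have hβ' := hfin.mem_toFinset.1 hβ
  rw [map_smul, C.killingForm_e_neg_eq_zero φ
    (C.pos_subset (RootSystemData.cascade_subset_pos hβ')) (fun h => hφ (h ▸ hβ')), smul_zero]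

/-- A product over the cascade as a product over the positive roots. -/
@[to_additive]
lemma finprod_cascade_eq_prod {M : Type*} [CommMonoid M] [Fintype C.Pos]
    (F : V → M) (h : ∀ i : C.Pos, (i : V) ∉ C.toRootSystemData.cascade → F i = 1) :
    ∏ᶠ β ∈ C.toRootSystemData.cascade, F β = ∏ i : C.Pos, F i := by
  rw [← finprod_eq_prod_of_fintype, finprod_set_coe_eq_finprod_mem C.Pos]
  refine finprod_mem_inter_mulSupport_eq _ _ _ (Set.ext fun β => ?_)
  refine and_congr_left fun hβ => ⟨fun h' => RootSystemData.cascade_subset_pos h', fun h' => ?_⟩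
  by_contra hc
  exact hβ (h ⟨β, h'⟩ hc)

end CascadeLieData

/-- Let `ξ ∈ S(𝔫)^𝔫` be a nonzero `𝔥`-weight vector of weight `ν` (with
`S(𝔫)` realized as the polynomial ring on `{e_φ : φ ∈ Δ₊}` as above).  Then each
`(ν,β)/(β,β)`, `β ∈ ℬ`, is a nonnegative integer `k_β`; `ξ` is homogeneous of degree
`r(ν) = Σ_{β∈ℬ} (ν,β)/(β,β)`; and there is a nonzero constant `s` such that, identifying
`S(𝔫)` with the polynomial functions on `𝔫₋` via the Killing form pairing, for every
`t = Σ_{β∈ℬ} t_β e_{−β} ∈ 𝔯₋ˣ` one has `ξ(t) = s ⬝ Π_{β∈ℬ} t_β^{(ν,β)/(β,β)}`. -/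
theorem statement19 {V : Type*} [NormedAddCommGroup V] [InnerProductSpace ℝ V]
    {L : Type*} [LieRing L] [LieAlgebra ℂ L] [Module.Finite ℂ L]
    (C : CascadeLieData V L)
    (ι : L →ₗ[ℂ] MvPolynomial (↥C.Pos) ℂ)
    (hι : ∀ φ : ↥C.Pos, ι (C.e φ) = MvPolynomial.X φ)
    (Dn : L → Derivation ℂ (MvPolynomial (↥C.Pos) ℂ) (MvPolynomial (↥C.Pos) ℂ))
    (hDn : ∀ v ∈ C.nSub, ∀ w ∈ C.nSub, Dn v (ι w) = ι ⁅v, w⁆)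
    (Dh : C.H → Derivation ℂ (MvPolynomial (↥C.Pos) ℂ) (MvPolynomial (↥C.Pos) ℂ))
    (hDh : ∀ x : C.H, ∀ w ∈ C.nSub, Dh x (ι w) = ι ⁅(x : L), w⁆)
    (ν : V) (ξ : MvPolynomial (↥C.Pos) ℂ)
    (hinv : ∀ v ∈ C.nSub, Dn v ξ = 0)
    (hwt : ∀ x : C.H, Dh x ξ = C.wt ν x • ξ) (hne : ξ ≠ 0) :
    ∃ k : V → ℕ,
      (∀ β ∈ C.toRootSystemData.cascade, (k β : ℝ) = ⟪ν, β⟫_ℝ / ⟪β, β⟫_ℝ) ∧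
      (∃ n : ℕ, ξ.IsHomogeneous n ∧
        (n : ℝ) = ∑ᶠ β ∈ C.toRootSystemData.cascade, ⟪ν, β⟫_ℝ / ⟪β, β⟫_ℝ) ∧
      ∃ s : ℂ, s ≠ 0 ∧ ∀ t : V → ℂ, (∀ β ∈ C.toRootSystemData.cascade, t β ≠ 0) →
        MvPolynomial.eval (fun φ : ↥C.Pos =>
            killingForm ℂ L (C.e φ)
              (∑ᶠ β ∈ C.toRootSystemData.cascade, t β • C.e (-β))) ξ
          = s * ∏ᶠ β ∈ C.toRootSystemData.cascade, t β ^ (k β) := by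
  classical
  have : Fintype ↥C.Pos := C.toRootSystemData.pos_finite.fintype
  obtain ⟨d, hd⟩ := Finset.nonempty_iff_ne_empty.2 (mt MvPolynomial.support_eq_empty.1 hne)
  obtain ⟨d₀, hd₀, -, hd₀B⟩ := CascadeLieData.exists_cascade_monomial hι hDn hinv hd
  have hexp : ∀ d' ∈ ξ.support,
      (∀ i : ↥C.Pos, (i : V) ∉ C.toRootSystemData.cascade → d' i = 0) →
      ∀ β : ↥C.Pos, (β : V) ∈ C.toRootSystemData.cascade →
        (d' β : ℝ) = ⟪ν, (β : V)⟫_ℝ / ⟪(β : V), (β : V)⟫_ℝ := fun d' hd' hB β hβ =>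
    CascadeLieData.exponent_eq (CascadeLieData.sum_smul_eq_weight hι hDh hwt hd') hB hβ
  have huniq : ∀ d' ∈ ξ.support,
      (∀ i : ↥C.Pos, (i : V) ∉ C.toRootSystemData.cascade → d' i = 0) → d' = d₀ := by
    refine fun d' hd' hB => Finsupp.ext fun i => ?_
    by_cases hi : (i : V) ∈ C.toRootSystemData.cascade
    · exact_mod_cast (hexp d' hd' hB i hi).trans (hexp d₀ hd₀ hd₀B i hi).symm
    · rw [hB i hi, hd₀B i hi]
  let k : V → ℕ := fun β => if h : β ∈ C.Pos then d₀ ⟨β, h⟩ else 0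
  have hk : ∀ i : ↥C.Pos, k i = d₀ i := fun i => dif_pos i.2
  have hkβ : ∀ β ∈ C.toRootSystemData.cascade, (k β : ℝ) = ⟪ν, β⟫_ℝ / ⟪β, β⟫_ℝ := fun β hβ => by
    have hβP := RootSystemData.cascade_subset_pos hβ
    rw [← hexp d₀ hd₀ hd₀B ⟨β, hβP⟩ hβ, ← hk ⟨β, hβP⟩]
  refine ⟨k, hkβ, ⟨d₀.degree, ?_, ?_⟩, ?_⟩
  · intro d' hd'
    obtain ⟨d₁, hd₁, hdeg, hd₁B⟩ := CascadeLieData.exists_cascade_monomial hι hDn hinv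
      (MvPolynomial.mem_support_iff.2 hd')
    rw [← huniq d₁ hd₁ hd₁B, hdeg]
    exact Finsupp.degree_eq_weight_one (R := ℕ) ▸ rfl
  · rw [← finsum_mem_congr rfl hkβ, CascadeLieData.finsum_cascade_eq_sum (fun β => (k β : ℝ))
      (fun i hi => by rw [hk, hd₀B i hi, Nat.cast_zero]), Finsupp.degree_eq_sum]
    push_cast
    exact Finset.sum_congr rfl fun i _ => by rw [hk]
  · refine ⟨MvPolynomial.coeff d₀ ξ *
      ∏ i : ↥C.Pos, killingForm ℂ L (C.e i) (C.e (-i)) ^ d₀ i, ?_, fun t _ => ?_⟩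
    · exact mul_ne_zero (MvPolynomial.mem_support_iff.1 hd₀) (Finset.prod_ne_zero_iff.2 fun i _ =>
        pow_ne_zero _ (C.killing_pair i (C.pos_subset i.2)))
    · rw [MvPolynomial.eval_eq', Finset.sum_eq_single_of_mem d₀ hd₀,
        CascadeLieData.finprod_cascade_eq_prod (fun β => t β ^ k β)
          (fun i hi => by rw [hk, hd₀B i hi, pow_zero]), mul_assoc, ← Finset.prod_mul_distrib]
      · congr 1
        refine Finset.prod_congr rfl fun i _ => ?_
        by_cases hi : (i : V) ∈ C.toRootSystemData.cascade
        · rw [CascadeLieData.killingForm_e_sum_of_mem hi, hk, mul_pow, mul_comm]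
        · rw [hk, hd₀B i hi, pow_zero, pow_zero, pow_zero, mul_one]
      · intro d' hd' hne'
        obtain ⟨i, hi, hi0⟩ : ∃ i : ↥C.Pos, (i : V) ∉ C.toRootSystemData.cascade ∧ d' i ≠ 0 := by
          by_contra! h
          exact hne' (huniq d' hd' h)
        rw [Finset.prod_eq_zero (Finset.mem_univ i), mul_zero]
        rw [CascadeLieData.killingForm_e_sum_of_notMem hi, zero_pow hi0]
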